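/- Adopt the setup of the tail-bound lemma for total distributions: p, q probability distributions with V(p) > 0, V(q) > 0; f sharp or uniform with H(f) ≠ H(p), H(f) ≠ H(q), (H(f) − H(p))/(H(f) − H(q)) > 0; (t_n) a moderate sequence; μ ∈ ℝ; m_n = ⌊n·(H(f) − H(p) + μ t_n)/(H(f) − H(q))⌋; P^n = p^{⊗n} ⊗ f^{⊗m_n}; Q^n = q^{⊗m_n} ⊗ f^{⊗n}; K_n(x) = exp( m_n H(q) + n H(f) + x·n·t_n ); ν = (V(p)/V(q))·(H(f) − H(q))/(H(f) − H(p)). Define z_C = μ/(1 − √ν) (when ν ≠ 1) and z_T = μ/(1 + √ν). Then: (i) for any bounded interval [a,b] with a > z_C if ν < 1, or with b < z_C if ν > 1, there exists N such that for all n ≥ N and all x ∈ [a,b], ∑_{i ≤ K_n(x)} (P^n)^↓_i > ∑_{i ≤ K_n(x)} (Q^n)^↓_i; and (ii) for any bounded interval [a,b] with b < z_T, there exists N such that for all n ≥ N and all x ∈ [a,b], ∑_{i ≥ K_n(x)} (P^n)^↓_i > ∑_{i ≤ K_n(x)} (Q^n)^↓_i. -/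

import Mathlib

open Finset Filter Real Topology

noncomputable section

/-- A probability distribution on a finite type: nonnegative entries summing to 1. -/
def IsProbDist {α : Type*} [Fintype α] (a : α → ℝ) : Prop :=
  (∀ i, 0 ≤ a i) ∧ ∑ i, a i = 1

/-- A sharp distribution: a single entry equal to 1, all others 0. -/
def IsSharp {α : Type*} [Fintype α] (a : α → ℝ) : Prop :=
  ∃ i, a i = 1 ∧ ∀ j, j ≠ i → a j = 0

/-- The uniform distribution: all entries equal to `1 / |α|`. -/
def IsUniform {α : Type*} [Fintype α] (a : α → ℝ) : Prop :=
  ∀ i, a i = 1 / (Fintype.card α : ℝ)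

/-- Tensor (Kronecker) product of two vectors. -/
def tensor {α β : Type*} (a : α → ℝ) (b : β → ℝ) : α × β → ℝ :=
  fun x => a x.1 * b x.2

/-- `n`-fold tensor power of a vector. -/
def tpow {α : Type*} (a : α → ℝ) (n : ℕ) : (Fin n → α) → ℝ :=
  fun f => ∏ j, a (f j)

/-- Shannon entropy (natural logarithm, with the convention `0 · ln 0 = 0`). -/
def shannonH {α : Type*} [Fintype α] (a : α → ℝ) : ℝ :=
  -∑ i, a i * Real.log (a i)

/-- Entropy variance `V(a) = ∑ i, a i (ln a i + H(a))²`. -/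
def entV {α : Type*} [Fintype α] (a : α → ℝ) : ℝ :=
  ∑ i, a i * (Real.log (a i) + shannonH a) ^ 2

/-- Relative entropy `D(a‖b)`. -/
def relD {α : Type*} [Fintype α] (a b : α → ℝ) : ℝ :=
  ∑ i, a i * Real.log (a i / b i)

/-- Relative entropy variance `V(a‖b)`. -/
def relV {α : Type*} [Fintype α] (a b : α → ℝ) : ℝ :=
  ∑ i, a i * (Real.log (a i / b i) - relD a b) ^ 2

/-- Total variation distance. -/
def tvd {α : Type*} [Fintype α] (a b : α → ℝ) : ℝ :=
  (1 / 2) * ∑ i, |a i - b i|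

/-- Fidelity `F(a,b) = (∑ i √(a i · b i))²`. -/
def fid {α : Type*} [Fintype α] (a b : α → ℝ) : ℝ :=
  (∑ i, Real.sqrt (a i * b i)) ^ 2

/-- The entries of `a` sorted in non-increasing order, as a vector on `Fin (card α)`. -/
def descSorted {α : Type*} [Fintype α] (a : α → ℝ) : Fin (Fintype.card α) → ℝ :=
  fun i =>
    a ((Fintype.equivFin α).symm
      (Tuple.sort (fun j => -a ((Fintype.equivFin α).symm j)) i))

/-- `headSum a K = ∑_{1 ≤ i ≤ K} a^↓_i` (1-based indices `i`, comparison `(i : ℝ) ≤ K`,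
equivalently `i ≤ ⌊K⌋`). -/
def headSum {α : Type*} [Fintype α] (a : α → ℝ) (K : ℝ) : ℝ :=
  ∑ i ∈ Finset.univ.filter (fun i : Fin (Fintype.card α) => ((i : ℕ) + 1 : ℝ) ≤ K),
    descSorted a i

/-- `tailSum a K = ∑_{i ≥ K} a^↓_i` (1-based indices `i`, comparison `K ≤ (i : ℝ)`,
equivalently `i ≥ ⌈K⌉`). -/
def tailSum {α : Type*} [Fintype α] (a : α → ℝ) (K : ℝ) : ℝ :=
  ∑ i ∈ Finset.univ.filter (fun i : Fin (Fintype.card α) => K ≤ ((i : ℕ) + 1 : ℝ)),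
    descSorted a i

/-- `a` majorises `b` (written `a ≻ b`): every partial sum of the non-increasingly sorted
`a` dominates the corresponding partial sum of sorted `b` (shorter vectors padded with zeros). -/
def Maj {α β : Type*} [Fintype α] [Fintype β] (a : α → ℝ) (b : β → ℝ) : Prop :=
  ∀ j : ℕ, headSum b (j : ℝ) ≤ headSum a (j : ℝ)

/-- `a ≻_ε b`: approximate majorisation (from above) with total variation error:
there is a probability distribution `b̃` with `a ≻ b̃` and `δ(b, b̃) ≤ ε`. -/
def ApproxMajTV {α β : Type*} [Fintype α] [Fintype β] (a : α → ℝ) (b : β → ℝ) (ε : ℝ) : Prop :=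
  ∃ bt : β → ℝ, IsProbDist bt ∧ Maj a bt ∧ tvd b bt ≤ ε

/-- `a ≺_ε b`: approximate majorisation (from below) with total variation error:
there is a probability distribution `b̃` with `a ≺ b̃` and `δ(b, b̃) ≤ ε`. -/
def ApproxSubMajTV {α β : Type*} [Fintype α] [Fintype β] (a : α → ℝ) (b : β → ℝ) (ε : ℝ) : Prop :=
  ∃ bt : β → ℝ, IsProbDist bt ∧ Maj bt a ∧ tvd b bt ≤ ε

/-- A moderate sequence: `t n → 0` and `√n · t n → +∞`. -/
def ModerateSeq (t : ℕ → ℝ) : Prop :=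
  Tendsto t atTop (𝓝 0) ∧ Tendsto (fun n : ℕ => Real.sqrt (n : ℝ) * t n) atTop atTop

/-- The uniform distribution on `Fin d`. -/
def unif (d : ℕ) : Fin d → ℝ := fun _ => 1 / (d : ℝ)

/-- The embedding map `Γ` associated with `γ_i = c_i / N`: for each `i` it produces
`c_i` entries equal to `a_i / c_i`. -/
def embed {d : ℕ} (c : Fin d → ℕ) (a : Fin d → ℝ) : (Σ i : Fin d, Fin (c i)) → ℝ :=
  fun x => a x.1 / (c x.1 : ℝ)

/-- Cut-and-pile modification of the sorted version of `a`, with cut at `K`: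
the first entry absorbs the total mass of entries at (1-based) positions `≥ K`,
entries at positions `1 < i < K` are unchanged, and entries at positions `≥ K` are set to 0. -/
def cutAndPile {α : Type*} [Fintype α] (a : α → ℝ) (K : ℝ) : Fin (Fintype.card α) → ℝ :=
  fun i =>
    if (i : ℕ) = 0 then descSorted a i + tailSum a K
    else if ((i : ℕ) + 1 : ℝ) < K then descSorted a i else 0

lemma sum_descSorted {α : Type*} [Fintype α] (a : α → ℝ) (g : ℝ → ℝ) :
    ∑ i, g (descSorted a i) = ∑ j, g (a j) := by
  unfold descSorted
  exact Equiv.sum_comp ((Tuple.sort (fun j => -a ((Fintype.equivFin α).symm j))).trans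
    (Fintype.equivFin α).symm) (fun j => g (a j))

lemma descSorted_antitone {α : Type*} [Fintype α] (a : α → ℝ) : Antitone (descSorted a) := by
  intro i j hij
  have := Tuple.monotone_sort (fun j => -a ((Fintype.equivFin α).symm j)) hij
  simpa [descSorted] using this

lemma IsProbDist.descSorted_nonneg {α : Type*} [Fintype α] {a : α → ℝ} (ha : IsProbDist a)
    (i) : 0 ≤ descSorted a i :=
  ha.1 _

lemma IsProbDist.sum_descSorted {α : Type*} [Fintype α] {a : α → ℝ} (ha : IsProbDist a) :
    ∑ i, descSorted a i = 1 :=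
  (_root_.sum_descSorted a id).trans ha.2

/-- The total mass of the entries of `a` that are at least `c`. -/
def massGE {α : Type*} [Fintype α] (a : α → ℝ) (c : ℝ) : ℝ :=
  ∑ i, if c ≤ a i then a i else 0

lemma massGE_le_headSum {α : Type*} [Fintype α] {a : α → ℝ} (ha : IsProbDist a) {c K : ℝ}
    (hc : 0 < c) (hK : 1 ≤ K * c) : massGE a c ≤ headSum a K := by
  rw [massGE, ← sum_descSorted a (fun r => if c ≤ r then r else 0), headSum, Finset.sum_filter]
  refine Finset.sum_le_sum fun i _ => ?_
  by_cases h : c ≤ descSorted a i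
  · have h1 : ((i : ℕ) + 1 : ℝ) * c ≤ 1 := by
      calc ((i : ℕ) + 1 : ℝ) * c = ∑ j ∈ Finset.Iic i, c := by simp
        _ ≤ ∑ j ∈ Finset.Iic i, descSorted a j :=
            Finset.sum_le_sum fun j hj =>
              h.trans (descSorted_antitone a (Finset.mem_Iic.1 hj))
        _ ≤ ∑ j, descSorted a j :=
            Finset.sum_le_sum_of_subset_of_nonneg (Finset.subset_univ _)
              fun j _ _ => ha.descSorted_nonneg j
        _ = 1 := ha.sum_descSorted
    have h2 : ((i : ℕ) + 1 : ℝ) ≤ K := le_of_mul_le_mul_right (h1.trans hK) hc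
    simp [h, h2]
  · rw [if_neg h]
    split_ifs
    exacts [ha.descSorted_nonneg i, le_rfl]

lemma headSum_le_massGE_add {α : Type*} [Fintype α] {a : α → ℝ} (ha : IsProbDist a) {c K : ℝ}
    (hc : 0 ≤ c) (hK : 0 ≤ K) : headSum a K ≤ massGE a c + K * c := by
  rw [massGE, ← sum_descSorted a (fun r => if c ≤ r then r else 0), headSum]
  set s := Finset.univ.filter (fun i : Fin (Fintype.card α) => ((i : ℕ) + 1 : ℝ) ≤ K) with hs
  have hcard : (s.card : ℝ) ≤ K := by
    have h1 : s.card ≤ ⌊K⌋₊ := by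
      rw [← Finset.card_range ⌊K⌋₊]
      refine Finset.card_le_card_of_injOn (fun i => (i : ℕ)) ?_ (Fin.val_injective.injOn)
      intro i hi
      have h2 : ((i : ℕ) + 1 : ℝ) ≤ K := by simpa [hs] using hi
      have h3 : (i : ℕ) + 1 ≤ ⌊K⌋₊ := Nat.le_floor (by exact_mod_cast h2)
      simpa using h3
    exact (Nat.cast_le.2 h1).trans (Nat.floor_le hK)
  calc ∑ i ∈ s, descSorted a i
      ≤ ∑ i ∈ s, ((if c ≤ descSorted a i then descSorted a i else 0) + c) := by
        refine Finset.sum_le_sum fun i _ => ?_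
        split_ifs with h
        · linarith
        · linarith
    _ = ∑ i ∈ s, (if c ≤ descSorted a i then descSorted a i else 0) + s.card * c := by
        rw [Finset.sum_add_distrib]; simp
    _ ≤ _ := by
        refine add_le_add (Finset.sum_le_sum_of_subset_of_nonneg (Finset.subset_univ _) ?_)
          (mul_le_mul_of_nonneg_right hcard hc)
        intro i _ _
        split_ifs
        exacts [ha.descSorted_nonneg i, le_rfl]

lemma headSum_mono {α : Type*} [Fintype α] {a : α → ℝ} (ha : IsProbDist a) :
    Monotone (headSum a) := by
  intro K K' h
  refine Finset.sum_le_sum_of_subset_of_nonneg ?_ fun i _ _ => ha.descSorted_nonneg i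
  intro i hi
  simp only [Finset.mem_filter, Finset.mem_univ, true_and] at hi ⊢
  exact hi.trans h

lemma one_sub_headSum_le_tailSum {α : Type*} [Fintype α] {a : α → ℝ} (ha : IsProbDist a)
    (K : ℝ) : 1 - headSum a K ≤ tailSum a K := by
  rw [← ha.sum_descSorted, headSum, tailSum, Finset.sum_filter, Finset.sum_filter,
    sub_le_iff_le_add, ← Finset.sum_add_distrib]
  refine Finset.sum_le_sum fun i _ => ?_
  have := ha.descSorted_nonneg i
  split_ifs <;> linarith

lemma IsProbDist.tensor {α β : Type*} [Fintype α] [Fintype β] {a : α → ℝ} {b : β → ℝ}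
    (ha : IsProbDist a) (hb : IsProbDist b) : IsProbDist (tensor a b) := by
  refine ⟨fun x => mul_nonneg (ha.1 _) (hb.1 _), ?_⟩
  simp only [_root_.tensor, Fintype.sum_prod_type, ← Finset.mul_sum, hb.2, ha.2, mul_one]

lemma IsProbDist.tpow {α : Type*} [Fintype α] {a : α → ℝ} (ha : IsProbDist a) (n : ℕ) :
    IsProbDist (tpow a n) := by
  classical
  refine ⟨fun x => Finset.prod_nonneg fun j _ => ha.1 _, ?_⟩
  simp only [_root_.tpow]
  rw [← Fintype.sum_pow, ha.2, one_pow]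

lemma sum_tpow_mul_exp {α : Type*} [Fintype α] (a Y : α → ℝ) (s : ℝ) (n : ℕ) :
    ∑ x, tpow a n x * exp (s * ∑ j, Y (x j)) = (∑ i, a i * exp (s * Y i)) ^ n := by
  classical
  rw [Fintype.sum_pow]
  refine Finset.sum_congr rfl fun x _ => ?_
  rw [Finset.prod_mul_distrib, ← Real.exp_sum, Finset.mul_sum, tpow]

lemma eq_zero_or_eq_exp_neg_shannonH {d : ℕ} {f : Fin d → ℝ}
    (h : IsSharp f ∨ IsUniform f) (i : Fin d) : f i = 0 ∨ f i = exp (-shannonH f) := by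
  rcases h with ⟨i₀, h1, h0⟩ | h
  · have hH : shannonH f = 0 := by
      rw [shannonH, neg_eq_zero]
      refine Finset.sum_eq_zero fun j _ => ?_
      by_cases hj : j = i₀
      · simp [hj, h1]
      · simp [h0 j hj]
    by_cases hj : i = i₀
    · right; simp [hH, hj, h1]
    · left; exact h0 i hj
  · right
    have hd : (0 : ℝ) < d := by exact_mod_cast i.pos
    have hH : shannonH f = Real.log d := by
      have : ∀ j, f j = 1 / (d : ℝ) := fun j => by simpa using h j
      simp only [shannonH, this]
      simp
      field_simp
    rw [hH, Real.exp_neg, Real.exp_log hd]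
    simpa using h i

lemma tpow_eq_zero_or_eq_exp {d : ℕ} {f : Fin d → ℝ}
    (h : IsSharp f ∨ IsUniform f) (l : ℕ) (y : Fin l → Fin d) :
    tpow f l y = 0 ∨ tpow f l y = exp (-(l * shannonH f)) := by
  by_cases h0 : ∃ j, f (y j) = 0
  · obtain ⟨j, hj⟩ := h0
    exact Or.inl (Finset.prod_eq_zero (Finset.mem_univ j) hj)
  · push Not at h0
    right
    have : ∀ j, f (y j) = exp (-shannonH f) := fun j =>
      (eq_zero_or_eq_exp_neg_shannonH h (y j)).resolve_left (h0 j)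
    simp only [tpow, this, Finset.prod_const, Finset.card_univ, Fintype.card_fin]
    rw [← Real.exp_nat_mul]
    ring_nf

lemma massGE_tensor_tpow {d e : ℕ} {p : Fin d → ℝ} {f : Fin e → ℝ} (hp : IsProbDist p)
    (hf : IsProbDist f) (h : IsSharp f ∨ IsUniform f) (k l : ℕ) (z : ℝ) :
    massGE (tensor (tpow p k) (tpow f l)) (exp (-(k * shannonH p + l * shannonH f + z))) =
      ∑ x, if ∑ j, (-Real.log (p (x j)) - shannonH p) ≤ z then tpow p k x else 0 := by
  have key : ∀ (x : Fin k → Fin d) (y : Fin l → Fin e),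
      (if exp (-(k * shannonH p + l * shannonH f + z)) ≤ tpow p k x * tpow f l y
        then tpow p k x * tpow f l y else 0) =
      (if ∑ j, (-Real.log (p (x j)) - shannonH p) ≤ z then tpow p k x else 0) *
        tpow f l y := by
    intro x y
    rcases tpow_eq_zero_or_eq_exp h l y with hy | hy
    · simp [hy]
    rcases ((hp.tpow k).1 x).eq_or_lt with hx | hx
    · simp [← hx]
    · have hlog : tpow p k x = exp (∑ j, Real.log (p (x j))) := by
        rw [Real.exp_sum]
        refine Finset.prod_congr rfl fun j _ => (Real.exp_log ?_).symm
        refine lt_of_le_of_ne (hp.1 _) fun h0 => hx.ne' ?_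
        exact Finset.prod_eq_zero (Finset.mem_univ j) h0.symm
      have hiff : exp (-(k * shannonH p + l * shannonH f + z)) ≤ tpow p k x * tpow f l y ↔
          ∑ j, (-Real.log (p (x j)) - shannonH p) ≤ z := by
        rw [hy, hlog, ← Real.exp_add, Real.exp_le_exp, Finset.sum_sub_distrib,
          Finset.sum_neg_distrib]
        simp
        constructor <;> intro h <;> linarith
      by_cases hc : ∑ j, (-Real.log (p (x j)) - shannonH p) ≤ z
      · rw [if_pos hc, if_pos (hiff.2 hc)]
      · rw [if_neg hc, if_neg (fun h' => hc (hiff.1 h')), zero_mul]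
  simp only [massGE, tensor, Fintype.sum_prod_type]
  refine Finset.sum_congr rfl fun x _ => (Finset.sum_congr rfl fun y _ => key x y).trans ?_
  rw [← Finset.mul_sum, (hf.tpow l).2, mul_one]

/-- `g` decays exponentially at speed `N` with rate `R`, i.e. `-(log g) / N` tends to `R`. -/
def HasExpRate (N g : ℕ → ℝ) (R : ℝ) : Prop :=
  ∀ η > 0, ∀ᶠ n in atTop, exp (-N n * (R + η)) ≤ g n ∧ g n ≤ exp (-N n * (R - η))

lemma HasExpRate.eventually_lt {N g h : ℕ → ℝ} {R S : ℝ} (hN : Tendsto N atTop atTop)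
    (hg : HasExpRate N g R) (hh : HasExpRate N h S) (hRS : R < S) :
    ∀ᶠ n in atTop, h n < g n := by
  filter_upwards [hg ((S - R) / 4) (by linarith), hh ((S - R) / 4) (by linarith),
    hN.eventually_gt_atTop 0] with n h1 h2 h3
  refine h2.2.trans_lt (lt_of_lt_of_le (Real.exp_lt_exp.2 ?_) h1.1)
  nlinarith

lemma HasExpRate.eventually_lt_const {N g : ℕ → ℝ} {R : ℝ} (hN : Tendsto N atTop atTop)
    (hg : HasExpRate N g R) (hR : 0 < R) {c : ℝ} (hc : 0 < c) :
    ∀ᶠ n in atTop, g n < c := by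
  filter_upwards [hg (R / 2) (by linarith), hN.eventually_gt_atTop (-Real.log c / (R / 2))]
    with n h1 h2
  refine h1.2.trans_lt ?_
  rw [← Real.lt_log_iff_exp_lt hc]
  rw [div_lt_iff₀ (by linarith)] at h2
  linarith

lemma eventually_ne_nhdsGT_zero (c : ℝ) : ∀ᶠ ε in 𝓝[>] (0 : ℝ), ε ≠ c := by
  rcases eq_or_ne c 0 with rfl | hc
  · filter_upwards [self_mem_nhdsWithin] with ε hε using ne_of_gt hε
  · exact nhdsWithin_le_nhds (eventually_ne_nhds hc.symm)

section GaertnerEllis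

variable {Ω : Type*} [Fintype Ω] {w T : Ω → ℝ}

lemma sum_ite_le_mul_mgf (hw : ∀ x, 0 ≤ w x) {a τ : ℝ} (hτ : 0 ≤ τ) :
    ∑ x, (if a ≤ T x then w x else 0) ≤ exp (-τ * a) * ∑ x, w x * exp (τ * T x) := by
  rw [Finset.mul_sum]
  refine Finset.sum_le_sum fun x _ => ?_
  have h1 : exp (-τ * a) * (w x * exp (τ * T x)) = w x * exp (τ * (T x - a)) := by
    rw [mul_left_comm, ← Real.exp_add]; ring_nf
  rw [h1]
  split_ifs with h
  · exact le_mul_of_one_le_right (hw x)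
      (Real.one_le_exp (mul_nonneg hτ (sub_nonneg.2 h)))
  · exact mul_nonneg (hw x) (Real.exp_pos _).le

lemma mul_mgf_sub_le_sum_ite (hw : ∀ x, 0 ≤ w x) {a b τ l : ℝ} (hτ : 0 ≤ τ) (hl : 0 ≤ l) :
    exp (-τ * b) * (∑ x, w x * exp (τ * T x) -
        exp (-l * b) * ∑ x, w x * exp ((τ + l) * T x) -
        exp (l * a) * ∑ x, w x * exp ((τ - l) * T x)) ≤
      ∑ x, (if a ≤ T x then w x else 0) := by
  rw [Finset.mul_sum, Finset.mul_sum, ← Finset.sum_sub_distrib, ← Finset.sum_sub_distrib,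
    Finset.mul_sum]
  refine Finset.sum_le_sum fun x _ => ?_
  have h1 : exp (-l * b) * (w x * exp ((τ + l) * T x)) =
      w x * exp (τ * T x) * exp (l * (T x - b)) := by
    rw [mul_left_comm, ← Real.exp_add, mul_assoc, ← Real.exp_add]; ring_nf
  have h2 : exp (l * a) * (w x * exp ((τ - l) * T x)) =
      w x * exp (τ * T x) * exp (l * (a - T x)) := by
    rw [mul_left_comm, ← Real.exp_add, mul_assoc, ← Real.exp_add]; ring_nf
  rw [h1, h2]
  have h3 : 0 ≤ w x * exp (τ * T x) := mul_nonneg (hw x) (Real.exp_pos _).le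
  have h4 := mul_nonneg h3 (Real.exp_pos (l * (T x - b))).le
  have h5 := mul_nonneg h3 (Real.exp_pos (l * (a - T x))).le
  have hb := Real.exp_pos (-τ * b)
  split_ifs with h
  · rcases le_total (T x) b with hTb | hTb
    · calc _ ≤ exp (-τ * b) * (w x * exp (τ * T x)) :=
            mul_le_mul_of_nonneg_left (by linarith) hb.le
        _ = w x * exp (τ * (T x - b)) := by
            rw [mul_left_comm, ← Real.exp_add]; ring_nf
        _ ≤ w x := mul_le_of_le_one_right (hw x)
            (Real.exp_le_one_iff.2 (mul_nonpos_of_nonneg_of_nonpos hτ (by linarith)))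
    · have h6 : w x * exp (τ * T x) ≤ w x * exp (τ * T x) * exp (l * (T x - b)) :=
        le_mul_of_one_le_right h3 (Real.one_le_exp (mul_nonneg hl (by linarith)))
      exact (mul_nonpos_of_nonneg_of_nonpos hb.le (by linarith)).trans (hw x)
  · have h6 : w x * exp (τ * T x) ≤ w x * exp (τ * T x) * exp (l * (a - T x)) :=
      le_mul_of_one_le_right h3 (Real.one_le_exp (mul_nonneg hl (by linarith)))
    exact mul_nonpos_of_nonneg_of_nonpos hb.le (by linarith)

end GaertnerEllis

lemma hasExpRate_of_mgf {Ω : ℕ → Type*} [∀ n, Fintype (Ω n)] {w T : ∀ n, Ω n → ℝ}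
    (hw : ∀ n x, 0 ≤ w n x) {N : ℕ → ℝ} (hN : Tendsto N atTop atTop) {σ : ℝ} (hσ : 0 < σ)
    (hT : ∀ τ ≠ 0, ∀ ε > 0, ∀ᶠ n in atTop,
      exp (N n * (τ ^ 2 * σ / 2 - ε)) ≤ ∑ x, w n x * exp (τ * T n x) ∧
      ∑ x, w n x * exp (τ * T n x) ≤ exp (N n * (τ ^ 2 * σ / 2 + ε)))
    {y : ℝ} (hy : 0 < y) :
    HasExpRate N (fun n => ∑ x, if y * N n ≤ T n x then w n x else 0) (y ^ 2 / (2 * σ)) := by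
  intro η hη
  refine Filter.Eventually.and ?_ ?_
  · obtain ⟨δ, hδ0, hδ⟩ : ∃ δ > 0, 2 * y * δ + 7 / 4 * δ ^ 2 ≤ η * σ := by
      have h : ∀ᶠ δ in 𝓝[>] (0 : ℝ), 2 * y * δ + 7 / 4 * δ ^ 2 < η * σ := by
        refine nhdsWithin_le_nhds (ContinuousAt.eventually_lt (by fun_prop) (by fun_prop) ?_)
        simpa using mul_pos hη hσ
      obtain ⟨δ, h1, h2⟩ := (h.and self_mem_nhdsWithin).exists
      exact ⟨δ, h2, h1.le⟩
    set τ := (y + δ) / σ with hτ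
    set l := δ / σ with hl
    set ε := δ ^ 2 / (8 * σ) with hε
    have hτ0 : 0 < τ := by positivity
    have hl0 : 0 < l := by positivity
    have hε0 : 0 < ε := by positivity
    have hτl : τ - l ≠ 0 := by
      have : τ - l = y / σ := by rw [hτ, hl]; ring
      rw [this]; positivity
    filter_upwards [hT τ hτ0.ne' ε hε0, hT (τ + l) (by positivity) ε hε0,
      hT (τ - l) hτl ε hε0, hN.eventually_ge_atTop (1 / ε), hN.eventually_gt_atTop 0]
      with n h1 h2 h3 h4 h5
    refine le_trans ?_ (mul_mgf_sub_le_sum_ite (hw n) (b := (y + 2 * δ) * N n) hτ0.le hl0.le)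
    have e1 : exp (-l * ((y + 2 * δ) * N n)) * ∑ x, w n x * exp ((τ + l) * T n x) ≤
        exp (N n * (τ ^ 2 * σ / 2 - ε)) * exp (-2 * (N n * ε)) := by
      refine (mul_le_mul_of_nonneg_left h2.2 (Real.exp_pos _).le).trans ?_
      rw [← Real.exp_add, ← Real.exp_add]
      refine (Real.exp_le_exp.2 (le_of_eq ?_))
      rw [hτ, hl, hε]; field_simp; ring
    have e2 : exp (l * (y * N n)) * ∑ x, w n x * exp ((τ - l) * T n x) ≤
        exp (N n * (τ ^ 2 * σ / 2 - ε)) * exp (-2 * (N n * ε)) := by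
      refine (mul_le_mul_of_nonneg_left h3.2 (Real.exp_pos _).le).trans ?_
      rw [← Real.exp_add, ← Real.exp_add]
      refine (Real.exp_le_exp.2 (le_of_eq ?_))
      rw [hτ, hl, hε]; field_simp; ring
    have e3 : exp (-(N n * ε)) ≤ 1 / 2 := by
      rw [div_le_iff₀ hε0] at h4
      have := Real.exp_one_gt_d9
      calc exp (-(N n * ε)) ≤ exp (-1) := Real.exp_le_exp.2 (by linarith)
        _ = 1 / exp 1 := by rw [Real.exp_neg, one_div]
        _ ≤ 1 / 2 := one_div_le_one_div_of_le (by norm_num) (by linarith)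
    have e4 : exp (-2 * (N n * ε)) = exp (-(N n * ε)) ^ 2 := by
      rw [← Real.exp_nat_mul]; push_cast; ring_nf
    have e0 := Real.exp_pos (-(N n * ε))
    have e5 : exp (N n * (τ ^ 2 * σ / 2 - ε)) * exp (-(N n * ε)) ≤
        ∑ x, w n x * exp (τ * T n x) -
        exp (-l * ((y + 2 * δ) * N n)) * ∑ x, w n x * exp ((τ + l) * T n x) -
        exp (l * (y * N n)) * ∑ x, w n x * exp ((τ - l) * T n x) := by
      have hA := Real.exp_pos (N n * (τ ^ 2 * σ / 2 - ε))
      rw [e4] at e1 e2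
      have : exp (-(N n * ε)) ≤ 1 - 2 * exp (-(N n * ε)) ^ 2 := by nlinarith
      nlinarith [mul_le_mul_of_nonneg_left this hA.le, h1.1]
    refine le_trans ?_ (mul_le_mul_of_nonneg_left e5 (Real.exp_pos _).le)
    rw [← Real.exp_add, ← Real.exp_add]
    refine Real.exp_le_exp.2 ?_
    have e6 : -τ * ((y + 2 * δ) * N n) + (N n * (τ ^ 2 * σ / 2 - ε) + -(N n * ε)) =
        -N n * (y ^ 2 / (2 * σ) + (2 * y * δ + 7 / 4 * δ ^ 2) / σ) := by
      rw [hτ, hε]; field_simp; ring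
    rw [e6]
    have e7 : (2 * y * δ + 7 / 4 * δ ^ 2) / σ ≤ η := by rwa [div_le_iff₀ hσ]
    nlinarith
  · have hτ : 0 < y / σ := by positivity
    filter_upwards [hT (y / σ) hτ.ne' η hη] with n hn
    refine (sum_ite_le_mul_mgf (hw n) hτ.le).trans ?_
    refine (mul_le_mul_of_nonneg_left hn.2 (Real.exp_pos _).le).trans ?_
    rw [← Real.exp_add]
    refine Real.exp_le_exp.2 (le_of_eq ?_)
    field_simp
    ring

lemma HasExpRate.of_perturb {N g b : ℕ → ℝ} {G : ℝ → ℕ → ℝ} {σ y : ℝ} (hy : 0 < y)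
    (hN : Tendsto N atTop atTop) (hb : ∀ A, ∀ᶠ n in atTop, A * N n ≤ b n)
    (hG : ∀ z, 0 < z → HasExpRate N (G z) (z ^ 2 / (2 * σ)))
    (hlow : ∀ δ > 0, ∀ᶠ n in atTop, G (y + δ) n - exp (-(δ / 2 * b n)) ≤ g n)
    (hup : ∀ δ > 0, ∀ᶠ n in atTop, g n ≤ G (y - δ) n + exp (-(δ / 2 * b n))) :
    HasExpRate N g (y ^ 2 / (2 * σ)) := by
  intro η hη
  set R := y ^ 2 / (2 * σ) with hR
  obtain ⟨δ, hδ0, hδy, hδ1, hδ2⟩ : ∃ δ > 0, 0 < y - δ ∧ (y + δ) ^ 2 / (2 * σ) < R + η / 2 ∧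
      R - η / 2 < (y - δ) ^ 2 / (2 * σ) := by
    have h0 : ∀ᶠ δ in 𝓝[>] (0 : ℝ), 0 < y - δ :=
      nhdsWithin_le_nhds (ContinuousAt.eventually_lt (by fun_prop) (by fun_prop) (by simpa))
    have h1 : ∀ᶠ δ in 𝓝[>] (0 : ℝ), (y + δ) ^ 2 / (2 * σ) < R + η / 2 :=
      nhdsWithin_le_nhds (ContinuousAt.eventually_lt (by fun_prop) (by fun_prop)
        (by rw [add_zero, ← hR]; linarith))
    have h2 : ∀ᶠ δ in 𝓝[>] (0 : ℝ), R - η / 2 < (y - δ) ^ 2 / (2 * σ) :=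
      nhdsWithin_le_nhds (ContinuousAt.eventually_lt (by fun_prop) (by fun_prop)
        (by rw [sub_zero, ← hR]; linarith))
    obtain ⟨δ, hδ⟩ := (((h0.and h1).and h2).and self_mem_nhdsWithin).exists
    exact ⟨δ, hδ.2, hδ.1.1.1, hδ.1.1.2, hδ.1.2⟩
  filter_upwards [hG (y + δ) (by linarith) (η / 4) (by linarith),
    hG (y - δ) hδy (η / 4) (by linarith), hlow δ hδ0, hup δ hδ0,
    hb ((R + η) / (δ / 2)), hN.eventually_ge_atTop (4 * Real.log 2 / η),
    hN.eventually_gt_atTop 0] with n h1 h2 h3 h4 h5 h6 h7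
  have e1 : exp (-(δ / 2 * b n)) ≤ exp (-N n * (R + η)) := by
    refine Real.exp_le_exp.2 ?_
    rw [div_mul_eq_mul_div, div_le_iff₀ (by positivity)] at h5
    linarith
  have e2 : ∀ r : ℝ, 2 * exp (-N n * (r + η / 4)) ≤ exp (-N n * r) := by
    intro r
    rw [← Real.exp_log (show (0 : ℝ) < 2 by norm_num), ← Real.exp_add]
    refine Real.exp_le_exp.2 ?_
    rw [div_le_iff₀ hη] at h6
    linarith
  have e3 : exp (-N n * (R + 3 / 4 * η)) ≤ G (y + δ) n :=
    le_trans (Real.exp_le_exp.2 (by nlinarith)) h1.1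
  have e4 : G (y - δ) n ≤ exp (-N n * (R - 3 / 4 * η)) :=
    le_trans h2.2 (Real.exp_le_exp.2 (by nlinarith))
  have e5 : exp (-N n * (R + η)) ≤ exp (-N n * (R - 3 / 4 * η)) :=
    Real.exp_le_exp.2 (by nlinarith)
  have e6 := e2 (R + 3 / 4 * η)
  have e7 := e2 (R - η)
  rw [show R + 3 / 4 * η + η / 4 = R + η by ring] at e6
  rw [show R - η + η / 4 = R - 3 / 4 * η by ring] at e7
  constructor <;> linarith

lemma tendsto_exp_sub_one_sub_div_sq (c : ℝ) :
    Tendsto (fun s : ℝ => (exp (s * c) - 1 - s * c) / s ^ 2) (𝓝[≠] 0) (𝓝 (c ^ 2 / 2)) := by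
  rw [tendsto_iff_norm_sub_tendsto_zero]
  have hlim : Tendsto (fun s : ℝ => |s| * |c| ^ 3) (𝓝[≠] 0) (𝓝 0) := by
    have : Tendsto (fun s : ℝ => |s| * |c| ^ 3) (𝓝 0) (𝓝 (|0| * |c| ^ 3)) :=
      Continuous.tendsto (by fun_prop) 0
    simpa using this.mono_left nhdsWithin_le_nhds
  refine squeeze_zero' (Eventually.of_forall fun _ => norm_nonneg _) ?_ hlim
  have hsmall : ∀ᶠ s in 𝓝[≠] (0 : ℝ), |s * c| < 1 :=
    nhdsWithin_le_nhds (ContinuousAt.eventually_lt (by fun_prop) (by fun_prop) (by simp))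
  filter_upwards [hsmall, self_mem_nhdsWithin] with s hs hs0
  have hs0 : s ≠ 0 := hs0
  have hs2 : 0 < s ^ 2 := by positivity
  have hb := Real.exp_bound hs.le (n := 3) (by norm_num)
  simp only [Finset.sum_range_succ, Finset.sum_range_zero, Nat.factorial] at hb
  norm_num at hb
  have e : (exp (s * c) - 1 - s * c) / s ^ 2 - c ^ 2 / 2 =
      (exp (s * c) - (1 + s * c + (s * c) ^ 2 / 2)) / s ^ 2 := by
    field_simp; ring
  rw [e, Real.norm_eq_abs, abs_div, abs_of_pos hs2, div_le_iff₀ hs2]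
  have e2 : |s| * |c| ^ 3 * s ^ 2 = |s| ^ 3 * |c| ^ 3 := by rw [← sq_abs s]; ring
  rw [e2]
  have e3 : 0 ≤ |s| ^ 3 * |c| ^ 3 := by positivity
  rw [mul_pow |s|] at hb
  linarith

lemma tendsto_log_mgf_div_sq {ι : Type*} [Fintype ι] {w Y : ι → ℝ} (hw : ∑ i, w i = 1)
    (hY : ∑ i, w i * Y i = 0) :
    Tendsto (fun s : ℝ => Real.log (∑ i, w i * exp (s * Y i)) / s ^ 2) (𝓝[≠] 0)
      (𝓝 ((∑ i, w i * Y i ^ 2) / 2)) := by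
  set M : ℝ → ℝ := fun s => ∑ i, w i * exp (s * Y i) with hM
  have h1 : Tendsto (fun s => (M s - 1) / s ^ 2) (𝓝[≠] 0)
      (𝓝 ((∑ i, w i * Y i ^ 2) / 2)) := by
    have h := tendsto_finsetSum (Finset.univ : Finset ι) fun i _ =>
      (tendsto_exp_sub_one_sub_div_sq (Y i)).const_mul (w i)
    have e1 : ∑ i, w i * (Y i ^ 2 / 2) = (∑ i, w i * Y i ^ 2) / 2 := by
      rw [Finset.sum_div]; exact Finset.sum_congr rfl fun i _ => by ring
    rw [e1] at h
    refine h.congr fun s => ?_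
    have e2 : M s - 1 = ∑ i, w i * (exp (s * Y i) - 1 - s * Y i) := by
      have : ∀ i, w i * (exp (s * Y i) - 1 - s * Y i) =
          w i * exp (s * Y i) - w i - s * (w i * Y i) := fun i => by ring
      simp only [this, Finset.sum_sub_distrib, ← Finset.mul_sum, hw, hY, hM]
      ring
    rw [e2, Finset.sum_div]
    exact Finset.sum_congr rfl fun i _ => by ring
  have h2 : Tendsto M (𝓝[≠] 0) (𝓝 1) := by
    have : Tendsto M (𝓝 0) (𝓝 (M 0)) := Continuous.tendsto (by fun_prop) 0
    have h0 : M 0 = 1 := by simp [hM, hw]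
    rw [h0] at this
    exact this.mono_left nhdsWithin_le_nhds
  have h3 : Tendsto (fun s => (M s - 1) / s ^ 2 / M s) (𝓝[≠] 0)
      (𝓝 ((∑ i, w i * Y i ^ 2) / 2)) := by
    have h := h1.div h2 one_ne_zero
    rw [div_one] at h
    exact h
  have hpos : ∀ᶠ s in 𝓝[≠] (0 : ℝ), 0 < M s := h2.eventually_const_lt one_pos
  refine tendsto_of_tendsto_of_tendsto_of_le_of_le' h3 h1 ?_ ?_
  · filter_upwards [hpos] with s hs
    rw [div_right_comm]
    refine div_le_div_of_nonneg_right ?_ (sq_nonneg s)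
    have := Real.one_sub_inv_le_log_of_pos hs
    rwa [sub_div, div_self hs.ne', one_div]
  · filter_upwards [hpos] with s hs
    exact div_le_div_of_nonneg_right (Real.log_le_sub_one_of_pos hs) (sq_nonneg s)

lemma ModerateSeq.eventually_pos {t : ℕ → ℝ} (ht : ModerateSeq t) :
    ∀ᶠ n in atTop, 0 < t n := by
  filter_upwards [ht.2.eventually_gt_atTop 0] with n hn
  exact pos_of_mul_pos_right hn (Real.sqrt_nonneg _)

lemma ModerateSeq.tendsto_mul_sq {t : ℕ → ℝ} (ht : ModerateSeq t) :
    Tendsto (fun n : ℕ => n * t n ^ 2) atTop atTop := by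
  refine (ht.2.atTop_mul_atTop₀ ht.2).congr fun n => ?_
  nth_rewrite 3 [← Real.sq_sqrt (Nat.cast_nonneg n : (0 : ℝ) ≤ n)]
  ring

lemma ModerateSeq.eventually_mul_le {t : ℕ → ℝ} (ht : ModerateSeq t) (A : ℝ) :
    ∀ᶠ n : ℕ in atTop, A * (n * t n ^ 2) ≤ n * t n := by
  have h : Tendsto (fun n => A * t n) atTop (𝓝 (A * 0)) := ht.1.const_mul A
  rw [mul_zero] at h
  filter_upwards [h.eventually_lt_const one_pos, ht.eventually_pos] with n h1 h2
  have : 0 ≤ (n : ℝ) * t n := by positivity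
  nlinarith

lemma ModerateSeq.tendsto_mul {t : ℕ → ℝ} (ht : ModerateSeq t) :
    Tendsto (fun n : ℕ => n * t n) atTop atTop := by
  refine tendsto_atTop_mono' _ ?_ ht.tendsto_mul_sq
  filter_upwards [ht.eventually_mul_le 1] with n hn
  rwa [one_mul] at hn

lemma hasExpRate_sum_iid {d : ℕ} {p Y : Fin d → ℝ} (hp : IsProbDist p)
    (hY : ∑ i, p i * Y i = 0) (hV : 0 < ∑ i, p i * Y i ^ 2) {t : ℕ → ℝ} (ht : ModerateSeq t)
    {k : ℕ → ℕ} {r : ℝ} (hr : 0 < r) (hk : Tendsto (fun n : ℕ => (k n : ℝ) / n) atTop (𝓝 r))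
    {y : ℝ} (hy : 0 < y) :
    HasExpRate (fun n => n * t n ^ 2)
      (fun n => ∑ x, if y * (n * t n ^ 2) ≤ t n * ∑ j, Y (x j) then tpow p (k n) x else 0)
      (y ^ 2 / (2 * (r * ∑ i, p i * Y i ^ 2))) := by
  refine hasExpRate_of_mgf (Ω := fun n => Fin (k n) → Fin d) (w := fun n => tpow p (k n))
    (T := fun n x => t n * ∑ j, Y (x j)) (fun n => (hp.tpow (k n)).1) ht.tendsto_mul_sq
    (mul_pos hr hV) ?_ hy
  intro τ hτ ε hε
  set V := ∑ i, p i * Y i ^ 2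
  set M : ℝ → ℝ := fun s => ∑ i, p i * exp (s * Y i) with hM
  have hMpos : ∀ s, 0 < M s := by
    intro s
    obtain ⟨i, hi⟩ : ∃ i, 0 < p i := by
      by_contra! h
      have := Finset.sum_nonpos fun i (_ : i ∈ Finset.univ) => h i
      rw [hp.2] at this
      linarith
    exact Finset.sum_pos' (fun i _ => mul_nonneg (hp.1 i) (Real.exp_pos _).le)
      ⟨i, Finset.mem_univ i, mul_pos hi (Real.exp_pos _)⟩
  have hs : Tendsto (fun n => τ * t n) atTop (𝓝[≠] 0) := by
    refine tendsto_nhdsWithin_iff.2 ⟨by simpa using ht.1.const_mul τ, ?_⟩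
    filter_upwards [ht.eventually_pos] with n hn using mul_ne_zero hτ hn.ne'
  have hlim := (hk.mul ((tendsto_log_mgf_div_sq hp.2 hY).comp hs)).const_mul (τ ^ 2)
  have e : τ ^ 2 * (r * (V / 2)) = τ ^ 2 * (r * V) / 2 := by ring
  rw [e] at hlim
  filter_upwards [hlim.eventually_const_lt (sub_lt_self _ hε),
    hlim.eventually_lt_const (lt_add_of_pos_right _ hε), ht.eventually_pos,
    eventually_gt_atTop 0] with n h1 h2 h3 h4
  have h4 : (0 : ℝ) < n := by exact_mod_cast h4
  have hN : 0 < n * t n ^ 2 := by positivity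
  have key : ∑ x, tpow p (k n) x * exp (τ * (t n * ∑ j, Y (x j))) =
      exp (n * t n ^ 2 * (τ ^ 2 * ((k n : ℝ) / n *
        (Real.log (M (τ * t n)) / (τ * t n) ^ 2)))) := by
    have e1 : ∀ x : Fin (k n) → Fin d, τ * (t n * ∑ j, Y (x j)) = τ * t n * ∑ j, Y (x j) :=
      fun x => by ring
    simp only [e1]
    rw [sum_tpow_mul_exp]
    change M (τ * t n) ^ k n = _
    rw [← Real.exp_log (pow_pos (hMpos (τ * t n)) (k n)), Real.log_pow]
    congr 1
    field_simp
  rw [key]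
  exact ⟨Real.exp_le_exp.2 (mul_le_mul_of_nonneg_left h1.le hN.le),
    Real.exp_le_exp.2 (mul_le_mul_of_nonneg_left h2.le hN.le)⟩

section HeadSum

variable {d e : ℕ} {p : Fin d → ℝ} {f : Fin e → ℝ}

lemma IsProbDist.sum_mul_information (hp : IsProbDist p) :
    ∑ i, p i * (-Real.log (p i) - shannonH p) = 0 := by
  simp only [mul_sub, Finset.sum_sub_distrib, ← Finset.sum_mul, hp.2, mul_neg,
    Finset.sum_neg_distrib]
  simp [shannonH]

lemma sum_mul_information_sq (p : Fin d → ℝ) :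
    ∑ i, p i * (-Real.log (p i) - shannonH p) ^ 2 = entV p := by
  refine Finset.sum_congr rfl fun i _ => ?_
  ring

lemma sum_ite_le_headSum (hp : IsProbDist p) (hf : IsProbDist f) (hfsu : IsSharp f ∨ IsUniform f)
    (k l : ℕ) (z : ℝ) :
    (∑ x, if ∑ j, (-Real.log (p (x j)) - shannonH p) ≤ z then tpow p k x else 0) ≤
      headSum (tensor (tpow p k) (tpow f l)) (exp (k * shannonH p + l * shannonH f + z)) := by
  rw [← massGE_tensor_tpow hp hf hfsu]
  refine massGE_le_headSum ((hp.tpow k).tensor (hf.tpow l)) (Real.exp_pos _) ?_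
  rw [← Real.exp_add, add_neg_cancel, Real.exp_zero]

lemma headSum_le_sum_ite_add (hp : IsProbDist p) (hf : IsProbDist f)
    (hfsu : IsSharp f ∨ IsUniform f) (k l : ℕ) (z u : ℝ) :
    headSum (tensor (tpow p k) (tpow f l)) (exp (k * shannonH p + l * shannonH f + z)) ≤
      (∑ x, if ∑ j, (-Real.log (p (x j)) - shannonH p) ≤ z + u then tpow p k x else 0) +
        exp (-u) := by
  rw [← massGE_tensor_tpow hp hf hfsu k l (z + u)]
  refine (headSum_le_massGE_add ((hp.tpow k).tensor (hf.tpow l))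
    (Real.exp_pos (-(k * shannonH p + l * shannonH f + (z + u)))).le
    (Real.exp_pos _).le).trans (le_of_eq ?_)
  rw [← Real.exp_add]
  ring_nf

variable (hp : IsProbDist p) (hf : IsProbDist f) (hfsu : IsSharp f ∨ IsUniform f)
  (hV : 0 < entV p) {t : ℕ → ℝ} (ht : ModerateSeq t) {k l : ℕ → ℕ} {r : ℝ} (hr : 0 < r)
  (hk : Tendsto (fun n : ℕ => (k n : ℝ) / n) atTop (𝓝 r)) {K y : ℕ → ℝ} {y₀ : ℝ}
  (hy : Tendsto y atTop (𝓝 y₀))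
  (hK : ∀ᶠ n in atTop, K n =
    exp (k n * shannonH p + l n * shannonH f + y n * (n * t n)))

include hp hf hfsu hV ht hr hk hy hK

lemma hasExpRate_headSum (hy₀ : y₀ < 0) :
    HasExpRate (fun n => n * t n ^ 2)
      (fun n => headSum (tensor (tpow p (k n)) (tpow f (l n))) (K n))
      (y₀ ^ 2 / (2 * (r * entV p))) := by
  set Y : Fin d → ℝ := fun i => -Real.log (p i) - shannonH p with hYdef
  have hG : ∀ z, 0 < z → HasExpRate (fun n => n * t n ^ 2)
      (fun n => ∑ x, if z * (n * t n ^ 2) ≤ t n * ∑ j, -Y (x j) then tpow p (k n) x else 0)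
      (z ^ 2 / (2 * (r * entV p))) := by
    intro z hz
    have hV' : ∑ i, p i * (-Y i) ^ 2 = entV p := by
      simp only [neg_sq]; exact sum_mul_information_sq p
    have h0 : ∑ i, p i * (-Y i) = 0 := by
      simp only [mul_neg, Finset.sum_neg_distrib]
      exact neg_eq_zero.2 hp.sum_mul_information
    have := hasExpRate_sum_iid hp h0 (hV'.symm ▸ hV) ht hr hk hz
    rwa [hV'] at this
  rw [← neg_sq]
  refine HasExpRate.of_perturb (neg_pos.2 hy₀) ht.tendsto_mul_sq ht.eventually_mul_le hG ?_ ?_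
  · intro δ hδ
    filter_upwards [hK, hy.eventually_const_lt (show y₀ - δ < y₀ by linarith),
      ht.eventually_pos] with n hKn hyn htn
    have hn : (0 : ℝ) ≤ n := Nat.cast_nonneg n
    rw [hKn]
    refine (sub_le_self _ (Real.exp_pos _).le).trans
      (le_trans (Finset.sum_le_sum fun x _ => ?_) (sum_ite_le_headSum hp hf hfsu _ _ _))
    have hx := (hp.tpow (k n)).1 x
    change _ ≤ if ∑ j, Y (x j) ≤ _ then _ else _
    split_ifs with h1 h2 h2
    · exact le_rfl
    · exfalso
      apply h2
      rw [Finset.sum_neg_distrib] at h1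
      refine le_of_mul_le_mul_left ?_ htn
      have := mul_le_mul_of_nonneg_right hyn.le (by positivity : 0 ≤ (n : ℝ) * t n ^ 2)
      nlinarith
    · exact hx
    · exact le_rfl
  · intro δ hδ
    filter_upwards [hK, hy.eventually_lt_const (show y₀ < y₀ + δ / 2 by linarith),
      ht.eventually_pos] with n hKn hyn htn
    have hn : (0 : ℝ) ≤ n := Nat.cast_nonneg n
    rw [hKn]
    refine (headSum_le_sum_ite_add hp hf hfsu _ _ _ (δ / 2 * (n * t n))).trans
      (add_le_add_left (Finset.sum_le_sum fun x _ => ?_) _)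
    have hx := (hp.tpow (k n)).1 x
    change (if ∑ j, Y (x j) ≤ _ then _ else _) ≤ _
    split_ifs with h1 h2 h2
    · exact le_rfl
    · exfalso
      apply h2
      rw [Finset.sum_neg_distrib]
      have := mul_le_mul_of_nonneg_right hyn.le (by positivity : 0 ≤ (n : ℝ) * t n ^ 2)
      have := mul_le_mul_of_nonneg_left h1 htn.le
      nlinarith
    · exact hx
    · exact le_rfl

lemma hasExpRate_one_sub_headSum (hy₀ : 0 < y₀) :
    HasExpRate (fun n => n * t n ^ 2)
      (fun n => 1 - headSum (tensor (tpow p (k n)) (tpow f (l n))) (K n))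
      (y₀ ^ 2 / (2 * (r * entV p))) := by
  set Y : Fin d → ℝ := fun i => -Real.log (p i) - shannonH p with hYdef
  have hG : ∀ z, 0 < z → HasExpRate (fun n => n * t n ^ 2)
      (fun n => ∑ x, if z * (n * t n ^ 2) ≤ t n * ∑ j, Y (x j) then tpow p (k n) x else 0)
      (z ^ 2 / (2 * (r * entV p))) := by
    intro z hz
    have hV' : ∑ i, p i * Y i ^ 2 = entV p := sum_mul_information_sq p
    have := hasExpRate_sum_iid hp hp.sum_mul_information (hV'.symm ▸ hV) ht hr hk hz
    rwa [hV'] at this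
  refine HasExpRate.of_perturb hy₀ ht.tendsto_mul_sq ht.eventually_mul_le hG ?_ ?_
  · intro δ hδ
    filter_upwards [hK, hy.eventually_lt_const (show y₀ < y₀ + δ / 2 by linarith),
      ht.eventually_pos, eventually_gt_atTop 0] with n hKn hyn htn hn
    have hn : (0 : ℝ) < n := by exact_mod_cast hn
    rw [hKn]
    have h0 : _ ≤ (∑ x, if ∑ j, Y (x j) ≤ y n * (n * t n) + δ / 2 * (n * t n)
        then tpow p (k n) x else 0) + exp (-(δ / 2 * (n * t n))) :=
      headSum_le_sum_ite_add hp hf hfsu (k n) (l n) (y n * (n * t n)) (δ / 2 * (n * t n))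
    have h3 : (∑ x, if (y₀ + δ) * (n * t n ^ 2) ≤ t n * ∑ j, Y (x j) then tpow p (k n) x
        else 0) + (∑ x, if ∑ j, Y (x j) ≤ y n * (n * t n) + δ / 2 * (n * t n)
          then tpow p (k n) x else 0) ≤ ∑ x, tpow p (k n) x := by
      rw [← Finset.sum_add_distrib]
      refine Finset.sum_le_sum fun x _ => ?_
      have hx := (hp.tpow (k n)).1 x
      split_ifs with h1 h2 h2
      · exfalso
        have := mul_lt_mul_of_pos_right hyn (by positivity : 0 < (n : ℝ) * t n ^ 2)
        have := mul_le_mul_of_nonneg_left h2 htn.le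
        nlinarith
      all_goals linarith
    rw [(hp.tpow (k n)).2] at h3
    linarith
  · intro δ hδ
    filter_upwards [hK, hy.eventually_const_lt (show y₀ - δ < y₀ by linarith),
      ht.eventually_pos] with n hKn hyn htn
    have hn : (0 : ℝ) ≤ n := Nat.cast_nonneg n
    rw [hKn]
    have h0 : (∑ x, if ∑ j, Y (x j) ≤ y n * (n * t n) then tpow p (k n) x else 0) ≤ _ :=
      sum_ite_le_headSum hp hf hfsu (k n) (l n) (y n * (n * t n))
    have h3 : ∑ x, tpow p (k n) x ≤
        (∑ x, if (y₀ - δ) * (n * t n ^ 2) ≤ t n * ∑ j, Y (x j) then tpow p (k n) x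
        else 0) + (∑ x, if ∑ j, Y (x j) ≤ y n * (n * t n) then tpow p (k n) x else 0) := by
      rw [← Finset.sum_add_distrib]
      refine Finset.sum_le_sum fun x _ => ?_
      have hx := (hp.tpow (k n)).1 x
      split_ifs with h1 h2 h2
      · linarith
      · linarith
      · linarith
      · exfalso
        push Not at h1 h2
        have := mul_le_mul_of_nonneg_right hyn.le (by positivity : 0 ≤ (n : ℝ) * t n ^ 2)
        have := mul_lt_mul_of_pos_left h2 htn
        nlinarith
    rw [(hp.tpow (k n)).2] at h3
    have := Real.exp_pos (-(δ / 2 * (n * t n)))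
    linarith

end HeadSum

lemma eventually_lt_of_hasExpRate {N F G : ℕ → ℝ} {u v c : ℝ} (hN : Tendsto N atTop atTop)
    (hc : 0 < c)
    (hFneg : u < 0 → HasExpRate N F (u ^ 2 / c))
    (hFpos : 0 < u → HasExpRate N (fun n => 1 - F n) (u ^ 2 / c))
    (hGneg : v < 0 → HasExpRate N G (v ^ 2 / c))
    (hGpos : 0 < v → HasExpRate N (fun n => 1 - G n) (v ^ 2 / c))
    (hu : u ≠ 0) (hv : v ≠ 0) (huv : u < v) : ∀ᶠ n in atTop, F n < G n := by
  rcases hu.lt_or_gt with hu | hu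
  · rcases hv.lt_or_gt with hv | hv
    · exact (hGneg hv).eventually_lt hN (hFneg hu)
        (div_lt_div_of_pos_right (by nlinarith) hc)
    · filter_upwards [(hFneg hu).eventually_lt_const hN (by positivity) (c := 1 / 2) (by norm_num),
        (hGpos hv).eventually_lt_const hN (by positivity) (c := 1 / 2) (by norm_num)] with n h1 h2
      linarith
  · have hv : 0 < v := hu.trans huv
    filter_upwards [(hFpos hu).eventually_lt hN (hGpos hv)
      (div_lt_div_of_pos_right (by nlinarith) hc)] with n hn
    linarith

lemma eventually_forall_mem_of_isCompact {s : Set ℝ} (hs : IsCompact s) {P : ℕ → ℝ → Prop}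
    (h : ∀ x ∈ s, ∃ U ∈ 𝓝 x, ∀ᶠ n in atTop, ∀ z ∈ U, P n z) :
    ∀ᶠ n in atTop, ∀ z ∈ s, P n z := by
  refine hs.induction_on (p := fun s => ∀ᶠ n in atTop, ∀ z ∈ s, P n z) (by simp) ?_ ?_ ?_
  · exact fun s t hst ht => ht.mono fun n hn z hz => hn z (hst hz)
  · intro s t hs ht
    filter_upwards [hs, ht] with n h1 h2 z hz
    exact hz.elim (h1 z) (h2 z)
  · intro x hx
    obtain ⟨U, hU, hP⟩ := h x hx
    exact ⟨U, mem_nhdsWithin_of_mem_nhds hU, hP⟩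

lemma abs_floor_sub_le {c : ℝ} (hc : 0 ≤ c) : |(⌊c⌋₊ : ℝ) - c| ≤ 1 := by
  rw [abs_le]
  constructor <;> linarith [Nat.floor_le hc, Nat.lt_floor_add_one c]

/-- Dominance of the total input distribution over the total output distribution,
uniformly on compact intervals beyond the crossing points `z_C` and `z_T`. -/
theorem dominance_of_total_states
    {dp dq df : ℕ} (p : Fin dp → ℝ) (q : Fin dq → ℝ) (f : Fin df → ℝ)
    (hp : IsProbDist p) (hq : IsProbDist q) (hf : IsProbDist f)
    (hfsu : IsSharp f ∨ IsUniform f)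
    (hVp : 0 < entV p) (hVq : 0 < entV q)
    (hfp : shannonH f ≠ shannonH p) (hfq : shannonH f ≠ shannonH q)
    (hratio : 0 < (shannonH f - shannonH p) / (shannonH f - shannonH q))
    (t : ℕ → ℝ) (ht : ModerateSeq t) (μ : ℝ)
    (m : ℕ → ℕ)
    (hm : ∀ n : ℕ, m n =
      ⌊(n : ℝ) * ((shannonH f - shannonH p + μ * t n) / (shannonH f - shannonH q))⌋₊)
    (K : ℕ → ℝ → ℝ)
    (hK : ∀ n : ℕ, ∀ x : ℝ, K n x =
      Real.exp ((m n : ℝ) * shannonH q + (n : ℝ) * shannonH f + x * n * t n))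
    (ν : ℝ)
    (hν : ν = (entV p / entV q) * ((shannonH f - shannonH q) / (shannonH f - shannonH p)))
    (zC zT : ℝ) (hzC : zC = μ / (1 - Real.sqrt ν)) (hzT : zT = μ / (1 + Real.sqrt ν)) :
    (∀ a b : ℝ, ((ν < 1 ∧ zC < a) ∨ (1 < ν ∧ b < zC)) →
      ∃ N : ℕ, ∀ n ≥ N, ∀ x ∈ Set.Icc a b,
        headSum (tensor (tpow q (m n)) (tpow f n)) (K n x) <
          headSum (tensor (tpow p n) (tpow f (m n))) (K n x)) ∧
    (∀ a b : ℝ, b < zT →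
      ∃ N : ℕ, ∀ n ≥ N, ∀ x ∈ Set.Icc a b,
        headSum (tensor (tpow q (m n)) (tpow f n)) (K n x) <
          tailSum (tensor (tpow p n) (tpow f (m n))) (K n x)) := by
  set A := shannonH f - shannonH p with hA
  set B := shannonH f - shannonH q with hB
  set r := A / B with hrdef
  set s := √ν with hsdef
  have hB0 : B ≠ 0 := sub_ne_zero.2 hfq
  have hA0 : A ≠ 0 := sub_ne_zero.2 hfp
  have hνr : ν = entV p / (entV q * r) := by rw [hν, hrdef]; field_simp
  have hν0 : 0 < ν := hνr ▸ by positivity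
  have hs0 : 0 < s := Real.sqrt_pos.2 hν0
  have hs2 : s ^ 2 = ν := Real.sq_sqrt hν0.le
  have hN := ht.tendsto_mul_sq
  have hc : Tendsto (fun n => (A + μ * t n) / B) atTop (𝓝 r) := by
    have := ((ht.1.const_mul μ).const_add A).div_const B
    rwa [mul_zero, add_zero] at this
  have hfloor : ∀ᶠ n in atTop, |(m n : ℝ) - n * ((A + μ * t n) / B)| ≤ 1 := by
    filter_upwards [hc.eventually_const_lt hratio] with n hn
    rw [hm n]
    exact abs_floor_sub_le (by positivity)
  have hmn : Tendsto (fun n : ℕ => (m n : ℝ) / n) atTop (𝓝 r) := by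
    have h0 : Tendsto (fun n : ℕ => (m n : ℝ) / n - (A + μ * t n) / B) atTop (𝓝 0) := by
      refine squeeze_zero_norm' ?_ tendsto_one_div_atTop_nhds_zero_nat
      filter_upwards [hfloor, eventually_gt_atTop 0] with n h1 h2
      have h2 : (0 : ℝ) < n := by exact_mod_cast h2
      have e : (m n : ℝ) / n - (A + μ * t n) / B =
          ((m n : ℝ) - n * ((A + μ * t n) / B)) / n := by field_simp
      rw [e, norm_div, Real.norm_eq_abs, Real.norm_of_nonneg h2.le]
      exact div_le_div_of_nonneg_right h1 h2.le
    simpa using h0.add hc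
  have hnn : Tendsto (fun n : ℕ => (n : ℝ) / n) atTop (𝓝 1) := by
    refine tendsto_const_nhds.congr' ?_
    filter_upwards [eventually_gt_atTop 0] with n hn
    rw [div_self (by exact_mod_cast hn.ne')]
  have hshift : ∀ x : ℝ, Tendsto (fun n => x + (n * A - m n * B) / (n * t n)) atTop
      (𝓝 (x - μ)) := by
    intro x
    have h0 : Tendsto (fun n => (n * A - m n * B) / (n * t n) + μ) atTop (𝓝 0) := by
      refine squeeze_zero_norm' ?_ (ht.tendsto_mul.const_div_atTop |B|)
      filter_upwards [hfloor, ht.eventually_pos, eventually_gt_atTop 0] with n h1 h2 h3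
      have h3 : (0 : ℝ) < n := by exact_mod_cast h3
      have e : (n * A - m n * B) / (n * t n) + μ =
          -(B * ((m n : ℝ) - n * ((A + μ * t n) / B))) / (n * t n) := by field_simp; ring
      rw [e, norm_div, norm_neg, norm_mul, Real.norm_of_nonneg (mul_pos h3 h2).le,
        Real.norm_eq_abs, Real.norm_eq_abs]
      exact div_le_div_of_nonneg_right (mul_le_of_le_one_right (abs_nonneg _) h1)
        (mul_pos h3 h2).le
    have := h0.const_add (x - μ)
    rw [add_zero] at this
    exact this.congr fun n => by ring
  have hKP : ∀ x : ℝ, ∀ᶠ n in atTop, K n x = exp (n * shannonH p + m n * shannonH f +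
      (x + (n * A - m n * B) / (n * t n)) * (n * t n)) := by
    intro x
    filter_upwards [ht.eventually_pos, eventually_gt_atTop 0] with n h2 h3
    have h3 : (0 : ℝ) < n := by exact_mod_cast h3
    have hnt : (n : ℝ) * t n ≠ 0 := (mul_pos h3 h2).ne'
    rw [hK, add_mul, div_mul_cancel₀ _ hnt, hA, hB]
    ring_nf
  have hKQ : ∀ x : ℝ, ∀ᶠ n in atTop, K n x = exp (m n * shannonH q + n * shannonH f +
      x * (n * t n)) :=
    fun x => Eventually.of_forall fun n => by rw [hK, mul_assoc]
  have hPr : ∀ u : ℝ, u ^ 2 / (2 * (1 * entV p)) = u ^ 2 / (2 * entV p) := fun u => by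
    rw [one_mul]
  have hQr : ∀ x : ℝ, x ^ 2 / (2 * (r * entV q)) = (s * x) ^ 2 / (2 * entV p) := fun x => by
    rw [mul_pow, hs2, hνr]; field_simp
  have hPneg : ∀ x, x - μ < 0 → _ := fun x hx => hPr (x - μ) ▸
    hasExpRate_headSum hp hf hfsu hVp ht one_pos hnn (hshift x) (hKP x) hx
  have hPpos : ∀ x, 0 < x - μ → _ := fun x hx => hPr (x - μ) ▸
    hasExpRate_one_sub_headSum hp hf hfsu hVp ht one_pos hnn (hshift x) (hKP x) hx
  have hQneg : ∀ x, s * x < 0 → _ := fun x hx => hQr x ▸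
    hasExpRate_headSum hq hf hfsu hVq ht hratio hmn tendsto_const_nhds (hKQ x)
      (neg_of_mul_neg_right hx hs0.le)
  have hQpos : ∀ x, 0 < s * x → _ := fun x hx => hQr x ▸
    hasExpRate_one_sub_headSum hq hf hfsu hVq ht hratio hmn tendsto_const_nhds (hKQ x)
      (pos_of_mul_pos_right hx hs0.le)
  have hKmono : ∀ᶠ n in atTop, Monotone (K n) := by
    filter_upwards [ht.eventually_pos] with n hn x x' hx
    rw [hK, hK]
    gcongr
  have hPd : ∀ n, IsProbDist (tensor (tpow p n) (tpow f (m n))) :=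
    fun n => (hp.tpow n).tensor (hf.tpow _)
  have hQd : ∀ n, IsProbDist (tensor (tpow q (m n)) (tpow f n)) :=
    fun n => (hq.tpow _).tensor (hf.tpow n)
  have hVp2 : 0 < 2 * entV p := by positivity
  constructor
  · intro a b hab
    refine eventually_atTop.1 (eventually_forall_mem_of_isCompact isCompact_Icc fun x hx => ?_)
    have hsx : s * x < x - μ := by
      rcases hab with ⟨h1, h2⟩ | ⟨h1, h2⟩
      · have hs1 : s < 1 := by nlinarith
        rw [hzC, div_lt_iff₀ (by linarith)] at h2
        nlinarith [hx.1]
      · have hs1 : 1 < s := by nlinarith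
        rw [hzC, lt_div_iff_of_neg (by linarith)] at h2
        nlinarith [hx.2]
    have hev : ∀ᶠ ε in 𝓝[>] (0 : ℝ), s * (x + ε) < x - ε - μ :=
      nhdsWithin_le_nhds (ContinuousAt.eventually_lt (by fun_prop) (by fun_prop) (by simpa))
    obtain ⟨ε, ⟨⟨hε1, hε2⟩, hε3⟩, hε0⟩ := (((hev.and (eventually_ne_nhdsGT_zero (-x))).and
      (eventually_ne_nhdsGT_zero (x - μ))).and self_mem_nhdsWithin).exists
    have hε0 : 0 < ε := hε0
    refine ⟨Set.Icc (x - ε) (x + ε), Icc_mem_nhds (by linarith) (by linarith), ?_⟩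
    filter_upwards [hKmono, eventually_lt_of_hasExpRate hN hVp2 (hQneg (x + ε)) (hQpos (x + ε))
      (hPneg (x - ε)) (hPpos (x - ε)) (mul_ne_zero hs0.ne' fun h => hε2 (by linarith))
      (fun h => hε3 (by linarith)) hε1] with n hmono hlt z hz
    exact ((headSum_mono (hQd n) (hmono hz.2)).trans_lt hlt).trans_le
      (headSum_mono (hPd n) (hmono hz.1))
  · intro a b hb
    refine eventually_atTop.1 (eventually_forall_mem_of_isCompact isCompact_Icc fun x hx => ?_)
    have hsx : s * x < -(x - μ) := by
      rw [hzT, lt_div_iff₀ (by linarith)] at hb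
      nlinarith [hx.2]
    have hev : ∀ᶠ ε in 𝓝[>] (0 : ℝ), s * (x + ε) < -(x + ε - μ) :=
      nhdsWithin_le_nhds (ContinuousAt.eventually_lt (by fun_prop) (by fun_prop) (by simpa using hsx))
    obtain ⟨ε, ⟨⟨hε1, hε2⟩, hε3⟩, hε0⟩ := (((hev.and (eventually_ne_nhdsGT_zero (-x))).and
      (eventually_ne_nhdsGT_zero (μ - x))).and self_mem_nhdsWithin).exists
    have hε0 : 0 < ε := hε0
    refine ⟨Set.Iic (x + ε), Iic_mem_nhds (by linarith), ?_⟩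
    filter_upwards [hKmono, eventually_lt_of_hasExpRate hN hVp2 (hQneg (x + ε)) (hQpos (x + ε))
      (fun h => neg_sq (x + ε - μ) ▸ hPpos (x + ε) (neg_lt_zero.1 h))
      (fun h => by simpa only [neg_sq, sub_sub_cancel] using hPneg (x + ε) (neg_pos.1 h))
      (mul_ne_zero hs0.ne' fun h => hε2 (by linarith))
      (neg_ne_zero.2 fun h => hε3 (by linarith)) hε1] with n hmono hlt z hz
    exact ((headSum_mono (hQd n) (hmono hz)).trans_lt hlt).trans_le
      ((sub_le_sub_left (headSum_mono (hPd n) (hmono hz)) 1).trans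
        (one_sub_headSum_le_tailSum (hPd n) _))
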